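/- Let κ > ω be regular. Suppose T is a countable complete first-order theory in a countable relational language such that for every α < κ⁺ there are η, η' ∈ κ^κ with M_η ⊨ T, M_{η'} ⊨ T, M_η ≡^α_{κ⁺κ} M_{η'} (the models satisfy the same L_{κ⁺κ}-sentences of quantifier rank ≤ α), and M_η ≇ M_{η'}. Then the isomorphism relation ≅_T ⊆ κ^κ × κ^κ is not κ-Borel. -/

import Mathlib

open Cardinal Set

universe u v w

namespace GDST

variable {K : Type u} {A : Type v}

/-- The set `N_η` determined by the partial function with domain `Y` and values given by `η`. -/
def nbhd (Y : Set K) (η : K → A) : Set (K → A) := {ζ | ∀ i ∈ Y, ζ i = η i}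

/-- Basic κ-open subsets of `K → K`: sets `N_η` where `η` is a partial function with
domain of size `< #K`, together with the empty set. -/
def IsBasicOpen (S : Set (K → A)) : Prop :=
  (∃ (Y : Set K) (η : K → A), #Y < #K ∧ S = nbhd Y η) ∨ S = ∅

/-- Open in the topology generated by the basic κ-open sets. -/
def IsOpenStd (U : Set (K → A)) : Prop :=
  ∀ ζ ∈ U, ∃ S : Set (K → A), IsBasicOpen S ∧ ζ ∈ S ∧ S ⊆ U

/-- A union of at most `μ` basic κ-open sets; `(κ,μ)`-open. -/
def IsMuOpen (μ : Cardinal.{u}) (U : Set (K → A)) : Prop :=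
  ∃ (ι : Type u) (f : ι → Set (K → A)), #ι ≤ μ ∧ (∀ i, IsBasicOpen (f i)) ∧ U = ⋃ i, f i

/-- `(κ,μ)`-closed: the complement is `(κ,μ)`-open. -/
def IsMuClosed (μ : Cardinal.{u}) (C : Set (K → A)) : Prop := IsMuOpen μ Cᶜ

/-- The `(κ,μ)`-Borel sets: the smallest class containing the basic κ-open sets and closed
under complements and unions and intersections of length at most `μ`. -/
inductive MuBorel (μ : Cardinal.{u}) : Set (K → A) → Prop
  | basic (S : Set (K → A)) : IsBasicOpen S → MuBorel μ S
  | compl (S : Set (K → A)) : MuBorel μ S → MuBorel μ Sᶜ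
  | iUnion (ι : Type u) (f : ι → Set (K → A)) : #ι ≤ μ → (∀ i, MuBorel μ (f i)) →
      MuBorel μ (⋃ i, f i)
  | iInter (ι : Type u) (f : ι → Set (K → A)) : #ι ≤ μ → (∀ i, MuBorel μ (f i)) →
      MuBorel μ (⋂ i, f i)

/-- κ-open: a union of at most `κ = #K` basic κ-open sets. -/
def IsKOpen (U : Set (K → A)) : Prop := IsMuOpen #K U

/-- κ-closed. -/
def IsKClosed (C : Set (K → A)) : Prop := IsMuClosed #K C

/-- κ-Borel. -/
def KBorel (S : Set (K → A)) : Prop := MuBorel #K S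

/- Product space versions, for subsets of `(K → A) × (K → B)`. -/
section Prod

variable {B : Type w}

/-- Basic κ-open subsets of the product: products of basic κ-open sets. -/
def IsBasicOpen2 (S : Set ((K → A) × (K → B))) : Prop :=
  ∃ (S₁ : Set (K → A)) (S₂ : Set (K → B)), IsBasicOpen S₁ ∧ IsBasicOpen S₂ ∧ S = S₁ ×ˢ S₂

def IsOpenStd2 (U : Set ((K → A) × (K → B))) : Prop :=
  ∀ p ∈ U, ∃ S, IsBasicOpen2 S ∧ p ∈ S ∧ S ⊆ U

def IsMuOpen2 (μ : Cardinal.{u}) (U : Set ((K → A) × (K → B))) : Prop :=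
  ∃ (ι : Type u) (f : ι → Set ((K → A) × (K → B))),
    #ι ≤ μ ∧ (∀ i, IsBasicOpen2 (f i)) ∧ U = ⋃ i, f i

def IsMuClosed2 (μ : Cardinal.{u}) (C : Set ((K → A) × (K → B))) : Prop := IsMuOpen2 μ Cᶜ

inductive MuBorel2 (μ : Cardinal.{u}) : Set ((K → A) × (K → B)) → Prop
  | basic (S : Set ((K → A) × (K → B))) : IsBasicOpen2 S → MuBorel2 μ S
  | compl (S : Set ((K → A) × (K → B))) : MuBorel2 μ S → MuBorel2 μ Sᶜ
  | iUnion (ι : Type u) (f : ι → Set ((K → A) × (K → B))) : #ι ≤ μ → (∀ i, MuBorel2 μ (f i)) →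
      MuBorel2 μ (⋃ i, f i)
  | iInter (ι : Type u) (f : ι → Set ((K → A) × (K → B))) : #ι ≤ μ → (∀ i, MuBorel2 μ (f i)) →
      MuBorel2 μ (⋂ i, f i)

def IsKOpen2 (U : Set ((K → A) × (K → B))) : Prop := IsMuOpen2 #K U

def IsKClosed2 (C : Set ((K → A) × (K → B))) : Prop := IsMuClosed2 #K C

def KBorel2 (S : Set ((K → A) × (K → B))) : Prop := MuBorel2 #K S

/-- κ-Σ¹₁ : projections of κ-Borel subsets of the product. -/
def KSigma11 (S : Set (K → A)) : Prop :=
  ∃ C : Set ((K → A) × (K → A)), KBorel2 C ∧ S = Prod.fst '' C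

end Prod

end GDST

namespace GDST

open FirstOrder

/-- The countable relational language with, for each arity n, relation symbols Q_m, m ∈ ℕ. -/
def Lrel : Language := ⟨fun _ => Empty, fun _ => ℕ⟩

variable {K : Type u}

/-- The interpretation of the relation Q_m (of arity n) in the structure coded by η:
Q_m(v) holds iff η(π(m,v)) > 0 (z being the least element of K). -/
def RelP [LinearOrder K] (z : K) (π : (Σ n : ℕ, ℕ × (Fin n → K)) ≃ K) (η : K → K)
    (n m : ℕ) (v : Fin n → K) : Prop :=
  z < η (π ⟨n, (m, v)⟩)

/-- The Lrel-structure M_η on K coded by η. -/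
def Mstr [LinearOrder K] (z : K) (π : (Σ n : ℕ, ℕ × (Fin n → K)) ≃ K) (η : K → K) :
    Lrel.Structure K where
  funMap := fun f _ => f.elim
  RelMap := fun {n} m v => RelP z π η n m v

/-- M_η is a model of the theory T. -/
def ModelsT [LinearOrder K] (z : K) (π : (Σ n : ℕ, ℕ × (Fin n → K)) ≃ K)
    (T : Lrel.Theory) (η : K → K) : Prop :=
  ∀ φ ∈ T, @FirstOrder.Language.Sentence.Realize Lrel K (Mstr z π η) φ

/-- M_η and M_ξ are isomorphic. -/
def IsoM [LinearOrder K] (z : K) (π : (Σ n : ℕ, ℕ × (Fin n → K)) ≃ K) (η ξ : K → K) : Prop :=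
  ∃ σ : K ≃ K, ∀ (n m : ℕ) (v : Fin n → K),
    RelP z π η n m v ↔ RelP z π ξ n m (fun i => σ (v i))

/-- A partial isomorphism between M_η and M_ξ of size < κ, given as a set of pairs. -/
def PIso [LinearOrder K] (z : K) (π : (Σ n : ℕ, ℕ × (Fin n → K)) ≃ K) (η ξ : K → K)
    (s : Set (K × K)) : Prop :=
  #s < #K ∧
  (∀ p ∈ s, ∀ q ∈ s, (p.1 = q.1 ↔ p.2 = q.2)) ∧
  ∀ (n m : ℕ) (v w : Fin n → K), (∀ i, (v i, w i) ∈ s) →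
    (RelP z π η n m v ↔ RelP z π ξ n m w)

/-- M_η ≡^α_{κ⁺κ} M_ξ: equivalence up to quantifier rank α of L_{κ⁺κ}, rendered via the
standard characterization through an α-indexed descending chain of back-and-forth families
of partial isomorphisms of size < κ with the (< κ)-extension property. -/
def EquivRk [LinearOrder K] (z : K) (π : (Σ n : ℕ, ℕ × (Fin n → K)) ≃ K)
    (a : Ordinal.{u}) (η ξ : K → K) : Prop :=
  ∃ I : Ordinal.{u} → Set (Set (K × K)),
    (∀ b : Ordinal.{u}, ∀ s ∈ I b, PIso z π η ξ s) ∧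
    (∅ : Set (K × K)) ∈ I a ∧
    ∀ b c : Ordinal.{u}, c < b → b ≤ a → ∀ s ∈ I b,
      (∀ A : Set K, #A < #K → ∃ s' ∈ I c, s ⊆ s' ∧ A ⊆ Prod.fst '' s') ∧
      (∀ B : Set K, #B < #K → ∃ s' ∈ I c, s ⊆ s' ∧ B ⊆ Prod.snd '' s')

end GDST

namespace GDST

open FirstOrder

variable {K : Type u}

/-- Codes for κ-Borel subsets of the product. -/
inductive Code (K : Type u) : Type u
  | basic (S : Set (K → K)) (Y : Set K) (ζ : K → K) : Code K
  | compl (c : Code K) : Code K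
  | inter (f : K → Code K) : Code K

/-- The set coded by a code. -/
def Code.Mem (p : (K → K) × (K → K)) : Code K → Prop
  | .basic S Y ζ => p.1 ∈ S ∧ p.2 ∈ nbhd Y ζ
  | .compl c => ¬ Code.Mem p c
  | .inter f => ∀ i, Code.Mem p (f i)

/-- Forcing conditions: partial injections of size `< κ`. -/
def Cond (p : Set (K × K)) : Prop :=
  #p < #K ∧ (∀ x ∈ p, ∀ y ∈ p, (x.1 = y.1 ↔ x.2 = y.2))

/-- The value prescribed at coordinate `i` when its tuple is sent to `w`. -/
noncomputable def cval [LinearOrder K] (z o : K) (π : (Σ n : ℕ, ℕ × (Fin n → K)) ≃ K)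
    (η : K → K) (i : K) (w : Fin (π.symm i).1 → K) : K :=
  open Classical in if RelP z π η (π.symm i).1 (π.symm i).2.1 w then o else z

/-- The condition `p` sends the tuple of coordinate `i` to `w`. -/
def Sends (π : (Σ n : ℕ, ℕ × (Fin n → K)) ≃ K) (p : Set (K × K)) (i : K)
    (w : Fin (π.symm i).1 → K) : Prop :=
  ∀ j, ((π.symm i).2.2 j, w j) ∈ p

/-- The forcing relation. -/
def Forces [LinearOrder K] (z o : K) (π : (Σ n : ℕ, ℕ × (Fin n → K)) ≃ K) (η₀ η : K → K) :
    Code K → Set (K × K) → Prop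
  | .basic S Y ζ => fun p => η₀ ∈ S ∧ ∀ q, Cond q → p ⊆ q → ∀ i ∈ Y, ∀ w,
      Sends π q i w → cval z o π η i w = ζ i
  | .compl c => fun p => ∀ q, Cond q → p ⊆ q → ¬ Forces z o π η₀ η c q
  | .inter f => fun p => ∀ i, Forces z o π η₀ η (f i) p

/-- Strong refutation of a code by a condition. -/
def Refutes [LinearOrder K] (z o : K) (π : (Σ n : ℕ, ℕ × (Fin n → K)) ≃ K) (η₀ η : K → K) :
    Code K → Set (K × K) → Prop
  | .basic S Y ζ => fun p => η₀ ∉ S ∨ ∃ i ∈ Y, ∃ w, Sends π p i w ∧ cval z o π η i w ≠ ζ i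
  | .compl c => fun p => Forces z o π η₀ η c p
  | .inter f => fun p => ∃ i, Forces z o π η₀ η (.compl (f i)) p

theorem Forces.mono [LinearOrder K] {z o : K} {π : (Σ n : ℕ, ℕ × (Fin n → K)) ≃ K}
    {η₀ η : K → K} {c : Code K} {p q : Set (K × K)} (h : Forces z o π η₀ η c p)
    (hpq : p ⊆ q) : Forces z o π η₀ η c q := by
  induction c with
  | basic S Y ζ => exact ⟨h.1, fun r hr hqr => h.2 r hr (hpq.trans hqr)⟩
  | compl c ih => exact fun r hr hqr => h r hr (hpq.trans hqr)
  | inter f ih => exact fun i => ih i (h i)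

theorem Refutes.forces [LinearOrder K] {z o : K} {π : (Σ n : ℕ, ℕ × (Fin n → K)) ≃ K}
    {η₀ η : K → K} {c : Code K} {p : Set (K × K)} (h : Refutes z o π η₀ η c p) :
    Forces z o π η₀ η (.compl c) p := by
  intro q hq hpq hf
  cases c with
  | basic S Y ζ =>
    rcases h with h | ⟨i, hi, w, hw, hne⟩
    · exact h hf.1
    · exact hne (hf.2 q hq subset_rfl i hi w (fun j => hpq (hw j)))
  | compl c => exact hf q hq subset_rfl (Forces.mono h hpq)
  | inter f =>
    obtain ⟨i, hi⟩ := h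
    exact hi q hq hpq (hf i)

theorem refutes_dense [LinearOrder K] {z o : K} {π : (Σ n : ℕ, ℕ × (Fin n → K)) ≃ K}
    {η₀ η : K → K} (c : Code K) {p : Set (K × K)} (hp : Cond p)
    (h : ¬ Forces z o π η₀ η c p) : ∃ q, Cond q ∧ p ⊆ q ∧ Refutes z o π η₀ η c q := by
  induction c with
  | basic S Y ζ =>
    by_cases hS : η₀ ∈ S
    · simp only [Forces, hS, true_and, not_forall] at h
      obtain ⟨q, hq, hpq, i, hi, w, hw, hne⟩ := h
      exact ⟨q, hq, hpq, Or.inr ⟨i, hi, w, hw, hne⟩⟩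
    · exact ⟨p, hp, subset_rfl, Or.inl hS⟩
  | compl c ih =>
    simp only [Forces, not_forall, not_not] at h
    obtain ⟨q, hq, hpq, hf⟩ := h
    exact ⟨q, hq, hpq, hf⟩
  | inter f ih =>
    simp only [Forces, not_forall] at h
    obtain ⟨i, hi⟩ := h
    obtain ⟨q, hq, hpq, hr⟩ := ih i hi
    exact ⟨q, hq, hpq, i, hr.forces⟩

/-- The code of the structure pulled back along a permutation. -/
noncomputable def pull [LinearOrder K] (z o : K) (π : (Σ n : ℕ, ℕ × (Fin n → K)) ≃ K)
    (η : K → K) (σ : K ≃ K) : K → K :=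
  fun i => cval z o π η i (fun j => σ ((π.symm i).2.2 j))

/-- The graph of a permutation. -/
def graph (σ : K ≃ K) : Set (K × K) := {x | σ x.1 = x.2}

theorem graph_inj (σ : K ≃ K) : ∀ x ∈ graph σ, ∀ y ∈ graph σ, (x.1 = y.1 ↔ x.2 = y.2) := by
  intro x hx y hy
  simp only [graph, mem_ofPred_eq] at hx hy
  rw [← hx, ← hy]
  exact σ.injective.eq_iff.symm

theorem cond_union (hinf : ℵ₀ ≤ #K) {σ : K ≃ K} {p q : Set (K × K)} (hp : #p < #K)
    (hq : #q < #K) (hpg : p ⊆ graph σ) (hqg : q ⊆ graph σ) : Cond (p ∪ q) :=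
  ⟨(mk_union_le p q).trans_lt (add_lt_of_lt hinf hp hq), fun x hx y hy =>
    graph_inj σ x (union_subset hpg hqg hx) y (union_subset hpg hqg hy)⟩

/-- Genericity of `σ` for a code. -/
def Gen [LinearOrder K] (z o : K) (π : (Σ n : ℕ, ℕ × (Fin n → K)) ≃ K) (η₀ η : K → K)
    (σ : K ≃ K) (c : Code K) : Prop :=
  ∃ p, Cond p ∧ p ⊆ graph σ ∧ (Forces z o π η₀ η c p ∨ Refutes z o π η₀ η c p)

/-- Genericity of `σ` for all subcodes of a code. -/
def GenAll [LinearOrder K] (z o : K) (π : (Σ n : ℕ, ℕ × (Fin n → K)) ≃ K) (η₀ η : K → K)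
    (σ : K ≃ K) : Code K → Prop
  | .basic S Y ζ => Gen z o π η₀ η σ (.basic S Y ζ)
  | .compl c => Gen z o π η₀ η σ (.compl c) ∧ GenAll z o π η₀ η σ c
  | .inter f => Gen z o π η₀ η σ (.inter f) ∧ ∀ i, GenAll z o π η₀ η σ (f i)

theorem GenAll.gen [LinearOrder K] {z o : K} {π : (Σ n : ℕ, ℕ × (Fin n → K)) ≃ K}
    {η₀ η : K → K} {σ : K ≃ K} {c : Code K} (h : GenAll z o π η₀ η σ c) :
    Gen z o π η₀ η σ c := by
  cases c with
  | basic S Y ζ => exact h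
  | compl c => exact h.1
  | inter f => exact h.1

theorem forces_compat [LinearOrder K] (hinf : ℵ₀ ≤ #K) {z o : K}
    {π : (Σ n : ℕ, ℕ × (Fin n → K)) ≃ K}
    {η₀ η : K → K} {σ : K ≃ K} {c : Code K} {p q : Set (K × K)} (hp : Cond p) (hq : Cond q)
    (hpg : p ⊆ graph σ) (hqg : q ⊆ graph σ) (h : Forces z o π η₀ η c p)
    (h' : Forces z o π η₀ η (.compl c) q) : False :=
  h' (p ∪ q) (cond_union hinf hp.1 hq.1 hpg hqg) subset_union_right (h.mono subset_union_left)

theorem finite_cond (hinf : ℵ₀ ≤ #K) (σ : K ≃ K) (n : ℕ) (v : Fin n → K) :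
    #(range fun j => (v j, σ (v j))) < #K :=
  (lt_aleph0_iff_set_finite.2 (finite_range _)).trans_le hinf

theorem truth [LinearOrder K] (hinf : ℵ₀ ≤ #K) {z o : K}
    {π : (Σ n : ℕ, ℕ × (Fin n → K)) ≃ K}
    {η₀ η : K → K} {σ : K ≃ K} {c : Code K} (hg : GenAll z o π η₀ η σ c) :
    (∀ p, Cond p → p ⊆ graph σ → Forces z o π η₀ η c p → c.Mem (η₀, pull z o π η σ)) ∧
    (∀ p, Cond p → p ⊆ graph σ → Forces z o π η₀ η (.compl c) p →
      ¬ c.Mem (η₀, pull z o π η σ)) := by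
  induction c with
  | basic S Y ζ =>
    refine ⟨fun p hp hpg hf => ⟨hf.1, fun i hi => ?_⟩, fun p hp hpg hf hm => ?_⟩
    · refine hf.2 (p ∪ range fun j => ((π.symm i).2.2 j, σ ((π.symm i).2.2 j)))
        (cond_union hinf hp.1 (finite_cond hinf σ _ _) hpg ?_) subset_union_left i hi _
        (fun j => Or.inr ⟨j, rfl⟩)
      rintro _ ⟨j, rfl⟩
      rfl
    · obtain ⟨q, hq, hqg, h | h⟩ := hg.gen
      · exact forces_compat hinf hq hp hqg hpg h hf
      · rcases h with h | ⟨i, hi, w, hw, hne⟩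
        · exact h hm.1
        · apply hne
          have : w = fun j => σ ((π.symm i).2.2 j) := funext fun j => (hqg (hw j)).symm
          rw [this]
          exact hm.2 i hi
  | compl c ih =>
    refine ⟨(ih hg.2).2, fun p hp hpg hf hm => ?_⟩
    obtain ⟨q, hq, hqg, h | h⟩ := hg.gen
    · exact forces_compat hinf hq hp hqg hpg h hf
    · exact hm ((ih hg.2).1 q hq hqg h)
  | inter f ih =>
    refine ⟨fun p hp hpg hf i => (ih i (hg.2 i)).1 p hp hpg (hf i), fun p hp hpg hf hm => ?_⟩
    obtain ⟨q, hq, hqg, h | ⟨i, h⟩⟩ := hg.gen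
    · exact forces_compat hinf hq hp hqg hpg h hf
    · exact (ih i (hg.2 i)).2 q hq hqg h (hm i)

/-- A set of conditions is dense. -/
def Dense' (D : Set (Set (K × K))) : Prop := ∀ p, Cond p → ∃ q ∈ D, Cond q ∧ p ⊆ q

theorem gen_family [LinearOrder K] (hinf : ℵ₀ ≤ #K) (z o : K)
    (π : (Σ n : ℕ, ℕ × (Fin n → K)) ≃ K) (η₀ η : K → K) (c : Code K) :
    ∃ (ι : Type u) (D : ι → Set (Set (K × K))), #ι ≤ #K ∧ (∀ i, Dense' (D i)) ∧
      ∀ σ : K ≃ K, (∀ i, ∃ p ∈ D i, Cond p ∧ p ⊆ graph σ) → GenAll z o π η₀ η σ c := by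
  have key : ∀ c : Code K,
      Dense' {p | Forces z o π η₀ η c p ∨ Refutes z o π η₀ η c p} := by
    intro c p hp
    by_cases h : Forces z o π η₀ η c p
    · exact ⟨p, Or.inl h, hp, subset_rfl⟩
    · obtain ⟨q, hq, hpq, hr⟩ := refutes_dense c hp h
      exact ⟨q, Or.inr hr, hq, hpq⟩
  have one_le : (1 : Cardinal.{u}) ≤ #K := one_le_aleph0.trans hinf
  induction c with
  | basic S Y ζ =>
    refine ⟨PUnit, fun _ => _, by simpa using one_le, fun _ => key (.basic S Y ζ),
      fun σ h => ?_⟩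
    obtain ⟨p, h1, h2, h3⟩ := h ⟨⟩
    exact ⟨p, h2, h3, h1⟩
  | compl c ih =>
    obtain ⟨ι, D, hι, hD, hG⟩ := ih
    refine ⟨Option ι, fun i => i.elim
      {p | Forces z o π η₀ η (.compl c) p ∨ Refutes z o π η₀ η (.compl c) p} D, ?_, fun i => ?_, fun σ h => ⟨?_, hG σ fun i => ?_⟩⟩
    · rw [mk_option]
      exact add_le_of_le hinf hι one_le
    · cases i with
      | none => exact key _
      | some i => exact hD i
    · obtain ⟨p, h1, h2, h3⟩ := h none
      exact ⟨p, h2, h3, h1⟩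
    · exact h (some i)
  | inter f ih =>
    choose ι D hι hD hG using ih
    refine ⟨Option (Σ k, ι k), fun i => i.elim
      {p | Forces z o π η₀ η (.inter f) p ∨ Refutes z o π η₀ η (.inter f) p} (fun x => D x.1 x.2), ?_, fun i => ?_,
      fun σ h => ⟨?_, fun k => hG k σ fun i => ?_⟩⟩
    · rw [mk_option]
      refine add_le_of_le hinf ?_ one_le
      rw [mk_sigma]
      refine (sum_le_sum _ (fun _ => #K) hι).trans ?_
      simp [mul_eq_self hinf]
    · cases i with
      | none => exact key _
      | some i => exact hD i.1 i.2
    · obtain ⟨p, h1, h2, h3⟩ := h none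
      exact ⟨p, h2, h3, h1⟩
    · exact h (some ⟨k, i⟩)

/-- Adding a point outside of the domain / range. -/
theorem exists_notMem (p : Set (K × K)) (hp : #p < #K) (f : K × K → K) :
    ∃ y, y ∉ f '' p := by
  by_contra h
  push Not at h
  have : f '' p = Set.univ := eq_univ_of_forall h
  have h2 : #(f '' p) ≤ #p := mk_image_le
  rw [this, mk_univ] at h2
  exact absurd hp (not_lt.2 h2)

theorem cond_insert (hinf : ℵ₀ ≤ #K) {p : Set (K × K)} (hp : Cond p) {x y : K}
    (hx : x ∉ Prod.fst '' p) (hy : y ∉ Prod.snd '' p) : Cond (insert (x, y) p) := by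
  refine ⟨mk_insert_le.trans_lt (add_lt_of_lt hinf hp.1 (one_lt_aleph0.trans_le hinf)), ?_⟩
  have h1 : ∀ a ∈ p, a.1 ≠ x := fun a ha h => hx ⟨a, ha, h⟩
  have h2 : ∀ a ∈ p, a.2 ≠ y := fun a ha h => hy ⟨a, ha, h⟩
  rintro a (rfl | ha) b (rfl | hb)
  · simp
  · simp [(h1 b hb).symm, (h2 b hb).symm]
  · simp [h1 a ha, h2 a ha]
  · exact hp.2 a ha b hb

theorem dense_dom (hinf : ℵ₀ ≤ #K) (x : K) : Dense' {p : Set (K × K) | x ∈ Prod.fst '' p} := by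
  intro p hp
  by_cases hx : x ∈ Prod.fst '' p
  · exact ⟨p, hx, hp, subset_rfl⟩
  · obtain ⟨y, hy⟩ := exists_notMem p hp.1 Prod.snd
    exact ⟨insert (x, y) p, ⟨(x, y), mem_insert _ _, rfl⟩, cond_insert hinf hp hx hy,
      subset_insert _ _⟩

theorem dense_ran (hinf : ℵ₀ ≤ #K) (y : K) : Dense' {p : Set (K × K) | y ∈ Prod.snd '' p} := by
  intro p hp
  by_cases hy : y ∈ Prod.snd '' p
  · exact ⟨p, hy, hp, subset_rfl⟩
  · obtain ⟨x, hx⟩ := exists_notMem p hp.1 Prod.fst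
    exact ⟨insert (x, y) p, ⟨(x, y), mem_insert _ _, rfl⟩, cond_insert hinf hp hx hy,
      subset_insert _ _⟩

/-- Generic chains. -/
theorem exists_chain (hreg : (#K).IsRegular) (p₀ : Set (K × K)) (hp₀ : Cond p₀)
    (D : (#K).ord.ToType → Set (Set (K × K))) (hD : ∀ i, Dense' (D i)) :
    ∃ F : (#K).ord.ToType → Set (K × K), (∀ a, Cond (F a) ∧ F a ∈ D a ∧ p₀ ⊆ F a) ∧
      ∀ a b, a < b → F a ⊆ F b := by
  have hinf := hreg.aleph0_le
  have hext : ∀ i p, ∃ q, Cond p → (q ∈ D i ∧ Cond q ∧ p ⊆ q) := by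
    intro i p
    by_cases hp : Cond p
    · obtain ⟨q, h⟩ := hD i p hp
      exact ⟨q, fun _ => ⟨h.1, h.2.1, h.2.2⟩⟩
    · exact ⟨∅, fun h => absurd h hp⟩
  choose E hE using hext
  have wf : WellFounded ((· < ·) : (#K).ord.ToType → (#K).ord.ToType → Prop) := wellFounded_lt
  let F : (#K).ord.ToType → Set (K × K) :=
    wf.fix (fun a r => E a (p₀ ∪ ⋃ b : Iio a, r b.1 b.2))
  have hF : ∀ a, F a = E a (p₀ ∪ ⋃ b : Iio a, F b.1) := fun a => wf.fix_eq _ a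
  have main : ∀ a, Cond (F a) ∧ F a ∈ D a ∧ (p₀ ∪ ⋃ b : Iio a, F b.1) ⊆ F a := by
    intro a
    induction a using wf.induction with
    | _ a ih =>
      have hc : Cond (p₀ ∪ ⋃ b : Iio a, F b.1) := by
        constructor
        · refine (mk_union_le _ _).trans_lt (add_lt_of_lt hinf hp₀.1 ?_)
          refine (mk_iUnion_le_sum_mk).trans_lt ?_
          refine sum_lt_of_isRegular hreg ?_ (fun b => (ih b.1 b.2).1.1)
          exact mk_Iio_toType_ord_lt a
        · have hch : ∀ x ∈ (p₀ ∪ ⋃ b : Iio a, F b.1), ∀ y ∈ (p₀ ∪ ⋃ b : Iio a, F b.1),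
              ∃ q, Cond q ∧ x ∈ q ∧ y ∈ q := by
            have hsub : ∀ b : Iio a, p₀ ⊆ F b.1 :=
              fun b => subset_union_left.trans (ih b.1 b.2).2.2
            have hmono : ∀ b c : Iio a, b.1 ≤ c.1 → F b.1 ⊆ F c.1 := by
              intro b c hbc
              rcases hbc.eq_or_lt with h | h
              · rw [h]
              · refine Subset.trans ?_ (ih c.1 c.2).2.2
                exact subset_union_of_subset_right
                  (subset_iUnion (fun b : Iio c.1 => F b.1) ⟨b.1, h⟩) _
            rintro x (hx | hx) y (hy | hy)
            · exact ⟨p₀, hp₀, hx, hy⟩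
            · obtain ⟨b, hb⟩ := mem_iUnion.1 hy
              exact ⟨_, (ih b.1 b.2).1, hsub b hx, hb⟩
            · obtain ⟨b, hb⟩ := mem_iUnion.1 hx
              exact ⟨_, (ih b.1 b.2).1, hb, hsub b hy⟩
            · obtain ⟨b, hb⟩ := mem_iUnion.1 hx
              obtain ⟨c, hc⟩ := mem_iUnion.1 hy
              rcases le_total b.1 c.1 with h | h
              · exact ⟨_, (ih c.1 c.2).1, hmono b c h hb, hc⟩
              · exact ⟨_, (ih b.1 b.2).1, hb, hmono c b h hc⟩
          intro x hx y hy
          obtain ⟨q, hq, hxq, hyq⟩ := hch x hx y hy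
          exact hq.2 x hxq y hyq
      have := hE a _ hc
      rw [← hF a] at this
      exact ⟨this.2.1, this.1, this.2.2⟩
  refine ⟨F, fun a => ⟨(main a).1, (main a).2.1, subset_union_left.trans (main a).2.2⟩,
    fun a b hab => ?_⟩
  refine Subset.trans ?_ (main b).2.2
  exact subset_union_of_subset_right
    (subset_iUnion (fun c : Iio b => F c.1) ⟨a, hab⟩) _

theorem exists_generic (hreg : (#K).IsRegular) (p₀ : Set (K × K)) (hp₀ : Cond p₀)
    (ι : Type u) (D : ι → Set (Set (K × K))) (hι : #ι ≤ #K) (hD : ∀ i, Dense' (D i)) :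
    ∃ σ : K ≃ K, p₀ ⊆ graph σ ∧ ∀ i, ∃ p ∈ D i, Cond p ∧ p ⊆ graph σ := by
  have hinf := hreg.aleph0_le
  have hne : Nonempty K := mk_ne_zero_iff.1 (aleph0_pos.trans_le hinf).ne'
  have hcard : #(ι ⊕ (K ⊕ K)) ≤ #((#K).ord.ToType) := by
    rw [mk_ord_toType]
    simp only [mk_sum, lift_id]
    exact add_le_of_le hinf hι (add_le_of_le hinf le_rfl le_rfl)
  obtain ⟨e⟩ := (le_def _ _).1 hcard
  have hne' : Nonempty (ι ⊕ (K ⊕ K)) := ⟨.inr (.inl hne.some)⟩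
  have hs : Function.Surjective (Function.invFun e) := Function.invFun_surjective e.injective
  let D' : ι ⊕ (K ⊕ K) → Set (Set (K × K)) :=
    Sum.elim D (Sum.elim (fun x => {p | x ∈ Prod.fst '' p}) (fun y => {p | y ∈ Prod.snd '' p}))
  have hD' : ∀ i, Dense' (D' i) := by
    rintro (i | x | y)
    · exact hD i
    · exact dense_dom hinf x
    · exact dense_ran hinf y
  obtain ⟨F, hF, hmono⟩ := exists_chain hreg p₀ hp₀ (fun a => D' (Function.invFun e a))
    (fun a => hD' _)
  have hmeet : ∀ i, ∃ a, F a ∈ D' i := by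
    intro i
    obtain ⟨a, ha⟩ := hs i
    exact ⟨a, ha ▸ (hF a).2.1⟩
  have hinj : ∀ a b, ∀ x ∈ F a, ∀ y ∈ F b, (x.1 = y.1 ↔ x.2 = y.2) := by
    intro a b x hx y hy
    rcases lt_trichotomy a b with h | h | h
    · exact (hF b).1.2 x (hmono a b h hx) y hy
    · subst h
      exact (hF a).1.2 x hx y hy
    · exact (hF a).1.2 x hx y (hmono b a h hy)
  have hdom : ∀ x, ∃ y, ∃ a, (x, y) ∈ F a := by
    intro x
    obtain ⟨a, ⟨x', y⟩, h, rfl⟩ := hmeet (.inr (.inl x))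
    exact ⟨y, a, h⟩
  choose g hg using hdom
  have hbij : Function.Bijective g := by
    constructor
    · intro x x' hxx
      obtain ⟨a, ha⟩ := hg x
      obtain ⟨b, hb⟩ := hg x'
      exact (hinj a b _ ha _ hb).2 hxx
    · intro y
      obtain ⟨a, ⟨x, y'⟩, h, rfl⟩ := hmeet (.inr (.inr y))
      obtain ⟨b, hb⟩ := hg x
      exact ⟨x, (hinj b a _ hb _ h).1 rfl⟩
  have hsub : ∀ a, F a ⊆ graph (Equiv.ofBijective g hbij) := by
    intro a x hx
    obtain ⟨b, hb⟩ := hg x.1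
    exact (hinj b a _ hb _ hx).1 rfl
  refine ⟨Equiv.ofBijective g hbij, ?_, fun i => ?_⟩
  · obtain ⟨a, -⟩ := hmeet (.inr (.inl hne.some))
    exact (hF a).2.2.trans (hsub a)
  · obtain ⟨a, ha⟩ := hmeet (.inl i)
    exact ⟨F a, ha, (hF a).1, hsub a⟩

/-- Rank of a code. -/
noncomputable def rk : Code K → Ordinal.{u}
  | .basic _ _ _ => 1
  | .compl c => Order.succ (rk c)
  | .inter f => ⨆ i, rk (f i)

theorem rk_lt (hinf : ℵ₀ ≤ #K) (c : Code K) : rk c < (Order.succ #K).ord := by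
  have hr : (Order.succ #K).IsRegular := isRegular_succ hinf
  induction c with
  | basic S Y ζ =>
    rw [rk, lt_ord, Ordinal.card_one]
    exact one_lt_aleph0.trans_le hr.aleph0_le
  | compl c ih => exact (isSuccLimit_ord hr.aleph0_le).succ_lt ih
  | inter f ih =>
    refine Ordinal.iSup_lt_of_lt_cof ?_ ih
    rw [hr.cof_ord]
    exact Order.lt_succ _

/-- The conditions `p` and `p'` correspond to each other via `s`. -/
def Corr (s p p' : Set (K × K)) : Prop :=
  (∀ x y, (x, y) ∈ p → ∃ y', (y, y') ∈ s ∧ (x, y') ∈ p') ∧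
  (∀ x y', (x, y') ∈ p' → ∃ y, (y, y') ∈ s ∧ (x, y) ∈ p)

theorem corr_ext {s s' p p' q' : Set (K × K)}
    (hs' : ∀ x ∈ s', ∀ y ∈ s', (x.1 = y.1 ↔ x.2 = y.2)) (hss : s ⊆ s')
    (hc : Corr s p p') (hq' : Cond q') (hpq : p' ⊆ q')
    (hr : Prod.snd '' q' ⊆ Prod.snd '' s') : ∃ q, Cond q ∧ p ⊆ q ∧ Corr s' q q' := by
  have hcov : ∀ x y', (x, y') ∈ q' → ∃ y, (y, y') ∈ s' := by
    intro x y' h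
    obtain ⟨⟨y, y''⟩, hy, rfl⟩ := hr ⟨(x, y'), h, rfl⟩
    exact ⟨y, hy⟩
  refine ⟨{x | ∃ y', (x.2, y') ∈ s' ∧ (x.1, y') ∈ q'}, ⟨?_, ?_⟩, ?_, ?_, ?_⟩
  · refine lt_of_le_of_lt ?_ hq'.1
    have : ∀ x : {x : K × K | ∃ y', (x.2, y') ∈ s' ∧ (x.1, y') ∈ q'},
        ∃ y', (x.1.2, y') ∈ s' ∧ (x.1.1, y') ∈ q' := fun x => x.2
    choose f hf using this
    refine mk_le_of_injective (f := fun x => (⟨(x.1.1, f x), (hf x).2⟩ : q')) ?_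
    intro a b hab
    have h1 : a.1.1 = b.1.1 := congrArg (fun t : q' => t.1.1) hab
    have h2 : f a = f b := congrArg (fun t : q' => t.1.2) hab
    exact Subtype.ext (Prod.ext h1 ((hs' _ (hf a).1 _ (hf b).1).2 h2))
  · rintro x ⟨a, ha, ha'⟩ y ⟨b, hb, hb'⟩
    exact (hq'.2 _ ha' _ hb').trans (hs' _ ha _ hb).symm
  · rintro ⟨x, y⟩ h
    obtain ⟨y', h1, h2⟩ := hc.1 x y h
    exact ⟨y', hss h1, hpq h2⟩
  · rintro x y ⟨y', h1, h2⟩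
    exact ⟨y', h1, h2⟩
  · intro x y' h
    obtain ⟨y, hy⟩ := hcov x y' h
    exact ⟨y, hy, y', hy, h⟩

theorem mem_swap {s : Set (K × K)} {x y : K} : (x, y) ∈ Prod.swap ⁻¹' s ↔ (y, x) ∈ s := Iff.rfl

theorem corr_swap {s p p' : Set (K × K)} (h : Corr s p p') : Corr (Prod.swap ⁻¹' s) p' p :=
  ⟨h.2, h.1⟩

/-- Back-and-forth systems of rank `a`. -/
def Sys [LinearOrder K] (z : K) (π : (Σ n : ℕ, ℕ × (Fin n → K)) ≃ K)
    (a : Ordinal.{u}) (η ξ : K → K) (I : Ordinal.{u} → Set (Set (K × K))) : Prop :=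
    (∀ b : Ordinal.{u}, ∀ s ∈ I b, PIso z π η ξ s) ∧
    ∀ b c : Ordinal.{u}, c < b → b ≤ a → ∀ s ∈ I b,
      (∀ A : Set K, #A < #K → ∃ s' ∈ I c, s ⊆ s' ∧ A ⊆ Prod.fst '' s') ∧
      (∀ B : Set K, #B < #K → ∃ s' ∈ I c, s ⊆ s' ∧ B ⊆ Prod.snd '' s')

theorem Sys.back [LinearOrder K] {z : K} {π : (Σ n : ℕ, ℕ × (Fin n → K)) ≃ K}
    {a : Ordinal.{u}} {η ξ : K → K} {I : Ordinal.{u} → Set (Set (K × K))}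
    (hI : Sys z π a η ξ I) {b c : Ordinal.{u}} (hcb : c < b) (hba : b ≤ a)
    {s p p' q' : Set (K × K)} (hs : s ∈ I b) (hc : Corr s p p') (hq' : Cond q')
    (hpq : p' ⊆ q') : ∃ s' ∈ I c, ∃ q, Cond q ∧ p ⊆ q ∧ Corr s' q q' := by
  obtain ⟨s', hs', hss, hr⟩ := (hI.2 b c hcb hba s hs).2 (Prod.snd '' q')
    (mk_image_le.trans_lt hq'.1)
  exact ⟨s', hs', corr_ext (hI.1 c s' hs').2.1 hss hc hq' hpq hr⟩

theorem Sys.forth [LinearOrder K] {z : K} {π : (Σ n : ℕ, ℕ × (Fin n → K)) ≃ K}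
    {a : Ordinal.{u}} {η ξ : K → K} {I : Ordinal.{u} → Set (Set (K × K))}
    (hI : Sys z π a η ξ I) {b c : Ordinal.{u}} (hcb : c < b) (hba : b ≤ a)
    {s p p' q : Set (K × K)} (hs : s ∈ I b) (hc : Corr s p p') (hq : Cond q)
    (hpq : p ⊆ q) : ∃ s' ∈ I c, ∃ q', Cond q' ∧ p' ⊆ q' ∧ Corr s' q q' := by
  obtain ⟨s', hs', hss, hr⟩ := (hI.2 b c hcb hba s hs).1 (Prod.snd '' q)
    (mk_image_le.trans_lt hq.1)
  have h1 : ∀ x ∈ Prod.swap ⁻¹' s', ∀ y ∈ Prod.swap ⁻¹' s', (x.1 = y.1 ↔ x.2 = y.2) :=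
    fun x hx y hy => ((hI.1 c s' hs').2.1 _ hx _ hy).symm
  have h2 : Prod.snd '' q ⊆ Prod.snd '' (Prod.swap ⁻¹' s') := by
    intro y hy
    obtain ⟨⟨u, v⟩, huv, rfl⟩ := hr hy
    exact ⟨(v, u), huv, rfl⟩
  obtain ⟨q', hq', hpq', hcq⟩ := corr_ext (s := Prod.swap ⁻¹' s) h1
    (preimage_mono hss) (corr_swap hc) hq hpq h2
  exact ⟨s', hs', q', hq', hpq', hcq.2, hcq.1⟩

theorem transfer [LinearOrder K] {z o : K} {π : (Σ n : ℕ, ℕ × (Fin n → K)) ≃ K}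
    {a : Ordinal.{u}} {η₀ η ξ : K → K} {I : Ordinal.{u} → Set (Set (K × K))}
    (hI : Sys z π a η ξ I) (c : Code K) : ∀ b, b ≤ a → rk c ≤ b → ∀ s ∈ I b, ∀ p p',
      Corr s p p' → (Forces z o π η₀ η c p ↔ Forces z o π η₀ ξ c p') := by
  have hval : ∀ (b) (s) (_ : s ∈ I b) (i : K) (w w' : Fin (π.symm i).1 → K),
      (∀ j, (w j, w' j) ∈ s) → cval z o π η i w = cval z o π ξ i w' := by
    intro b s hs i w w' h
    have := (hI.1 b s hs).2.2 (π.symm i).1 (π.symm i).2.1 w w' h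
    unfold cval
    by_cases h2 : RelP z π η (π.symm i).1 (π.symm i).2.1 w
    · rw [if_pos h2, if_pos (this.1 h2)]
    · rw [if_neg h2, if_neg (fun h3 => h2 (this.2 h3))]
  induction c with
  | basic S Y ζ =>
    intro b hba hb s hs p p' hc
    have h0 : (0 : Ordinal.{u}) < b := lt_of_lt_of_le zero_lt_one hb
    constructor
    · rintro ⟨hS, h⟩
      refine ⟨hS, fun q' hq' hpq' i hi w' hw' => ?_⟩
      obtain ⟨s', hs', q, hq, hpq, hcq⟩ := hI.back h0 hba hs hc hq' hpq'
      choose w hw1 hw2 using fun j => hcq.2 _ _ (hw' j)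
      rw [← hval 0 s' hs' i w w' hw1]
      exact h q hq hpq i hi w hw2
    · rintro ⟨hS, h⟩
      refine ⟨hS, fun q hq hpq i hi w hw => ?_⟩
      obtain ⟨s', hs', q', hq', hpq', hcq⟩ := hI.forth h0 hba hs hc hq hpq
      choose w' hw1 hw2 using fun j => hcq.1 _ _ (hw j)
      rw [hval 0 s' hs' i w w' hw1]
      exact h q' hq' hpq' i hi w' hw2
  | compl c ih =>
    intro b hba hb s hs p p' hc
    have h0 : rk c < b := lt_of_lt_of_le (Order.lt_succ _) hb
    constructor
    · intro h q' hq' hpq' hf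
      obtain ⟨s', hs', q, hq, hpq, hcq⟩ := hI.back h0 hba hs hc hq' hpq'
      exact h q hq hpq ((ih _ (h0.le.trans hba) le_rfl s' hs' q q' hcq).2 hf)
    · intro h q hq hpq hf
      obtain ⟨s', hs', q', hq', hpq', hcq⟩ := hI.forth h0 hba hs hc hq hpq
      exact h q' hq' hpq' ((ih _ (h0.le.trans hba) le_rfl s' hs' q q' hcq).1 hf)
  | inter f ih =>
    intro b hba hb s hs p p' hc
    exact forall_congr' fun i => ih i b hba
      ((Ordinal.le_iSup (fun i => rk (f i)) i).trans hb) s hs p p' hc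

theorem exists_code [LinearOrder K] (hinf : ℵ₀ ≤ #K) {S : Set ((K → K) × (K → K))}
    (hS : KBorel2 S) : ∃ c : Code K, ∀ p, c.Mem p ↔ p ∈ S := by
  have hne : Nonempty K := mk_ne_zero_iff.1 (aleph0_pos.trans_le hinf).ne'
  have hinter : ∀ (ι : Type u) (f : ι → Set ((K → K) × (K → K))), #ι ≤ #K →
      (∀ i, ∃ c : Code K, ∀ p, c.Mem p ↔ p ∈ f i) →
      ∃ c : Code K, ∀ p, c.Mem p ↔ p ∈ ⋂ i, f i := by
    intro ι f hι h
    choose c hc using h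
    rcases isEmpty_or_nonempty ι with he | he
    · refine ⟨.compl (.basic ∅ ∅ id), fun p => ?_⟩
      simp [Code.Mem]
    · obtain ⟨e⟩ := (le_def _ _).1 hι
      have hs : Function.Surjective (Function.invFun e) :=
        Function.invFun_surjective e.injective
      refine ⟨.inter fun k => c (Function.invFun e k), fun p => ?_⟩
      simp only [Code.Mem, hc, mem_iInter]
      exact (hs.forall (p := fun i => p ∈ f i)).symm
  have hcompl : ∀ S : Set ((K → K) × (K → K)), (∃ c : Code K, ∀ p, c.Mem p ↔ p ∈ S) →
      ∃ c : Code K, ∀ p, c.Mem p ↔ p ∈ Sᶜ := by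
    rintro S ⟨c, hc⟩
    exact ⟨.compl c, fun p => not_congr (hc p)⟩
  unfold KBorel2 at hS
  induction hS with
  | basic S h =>
    obtain ⟨S₁, S₂, -, h2, rfl⟩ := h
    rcases h2 with ⟨Y, ζ, -, rfl⟩ | rfl
    · exact ⟨.basic S₁ Y ζ, fun p => Iff.rfl⟩
    · exact ⟨.basic ∅ ∅ id, fun p => by simp [Code.Mem]⟩
  | compl S _ ih => exact hcompl S ih
  | iUnion ι f hι _ ih =>
    have := hcompl _ (hinter ι (fun i => (f i)ᶜ) hι fun i => hcompl _ (ih i))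
    simpa [compl_iInter] using this
  | iInter ι f hι _ ih => exact hinter ι f hι ih

theorem relP_pull [LinearOrder K] {z o : K} (ho : z < o)
    {π : (Σ n : ℕ, ℕ × (Fin n → K)) ≃ K} (η : K → K) (σ : K ≃ K) (n m : ℕ) (v : Fin n → K) :
    RelP z π (pull z o π η σ) n m v ↔ RelP z π η n m (fun i => σ (v i)) := by
  have key : ∀ t : (Σ n : ℕ, ℕ × (Fin n → K)),
      (z < (open Classical in
        if RelP z π η t.1 t.2.1 (fun j => σ (t.2.2 j)) then o else z)) ↔
      RelP z π η t.1 t.2.1 (fun j => σ (t.2.2 j)) := by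
    intro t
    split_ifs with h <;> simp [h, ho]
  have := key (π.symm (π ⟨n, (m, v)⟩))
  rw [RelP, pull, cval, this, Equiv.symm_apply_apply]

theorem models_iso [LinearOrder K] {z : K} {π : (Σ n : ℕ, ℕ × (Fin n → K)) ≃ K}
    {T : Lrel.Theory} {η ξ : K → K} (h : IsoM z π η ξ) (hη : ModelsT z π T ξ) :
    ModelsT z π T η := by
  obtain ⟨σ, hσ⟩ := h
  intro φ hφ
  let e : @Language.Equiv Lrel K K (Mstr z π η) (Mstr z π ξ) :=
    @Language.Equiv.mk Lrel K K (Mstr z π η) (Mstr z π ξ) σ (fun f => f.elim)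
      (fun {n} r v => (hσ n r v).symm)
  have := @Language.StrongHomClass.realize_sentence Lrel K K (Mstr z π η) (Mstr z π ξ) _ _ _ e φ
  exact this.2 (hη φ hφ)

end GDST

namespace GDST

open FirstOrder

/-- Let κ > ω be regular and T a complete first-order theory in the
countable relational language such that for every α < κ⁺ there are codes η, η' of
non-isomorphic models of T of size κ that are L_{κ⁺κ}-equivalent up to quantifier rank α.
Then the isomorphism relation of T on κ^κ is not κ-Borel. -/
theorem statement15 (K : Type u) [LinearOrder K]
    (hreg : (#K).IsRegular) (hunc : ℵ₀ < #K)
    (z : K) (hz : ∀ x : K, z ≤ x) (π : (Σ n : ℕ, ℕ × (Fin n → K)) ≃ K)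
    (T : Lrel.Theory) (hT : T.IsComplete)
    (hyp : ∀ a : Ordinal.{u}, a < (Order.succ (#K)).ord →
      ∃ η η' : K → K, ModelsT z π T η ∧ ModelsT z π T η' ∧
        EquivRk z π a η η' ∧ ¬ IsoM z π η η') :
    ¬ KBorel2 {p : (K → K) × (K → K) |
        (ModelsT z π T p.1 ∧ ModelsT z π T p.2 ∧ IsoM z π p.1 p.2) ∨
        (¬ ModelsT z π T p.1 ∧ ¬ ModelsT z π T p.2)} := by
  intro hB
  have hinf := hreg.aleph0_le
  obtain ⟨c, hc⟩ := exists_code hinf hB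
  obtain ⟨η, η', hm, hm', ⟨I, hI1, hI2, hI3⟩, hniso⟩ := hyp (rk c) (rk_lt hinf c)
  have hI : Sys z π (rk c) η η' I := ⟨hI1, hI3⟩
  have hnt : Nontrivial K := one_lt_iff_nontrivial.1 (one_lt_aleph0.trans_le hinf)
  obtain ⟨o, ho'⟩ := exists_ne z
  have ho : z < o := lt_of_le_of_ne (hz o) ho'.symm
  have hiso : ∀ ξ σ, IsoM z π (pull z o π ξ σ) ξ :=
    fun ξ σ => ⟨σ, fun n m v => relP_pull ho ξ σ n m v⟩
  have hsymm : ∀ ξ σ, IsoM z π ξ (pull z o π ξ σ) :=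
    fun ξ σ => ⟨σ.symm, fun n m v => by simp [relP_pull ho]⟩
  have hempty : Cond (∅ : Set (K × K)) :=
    ⟨by simpa using aleph0_pos.trans_le hinf, fun x hx => hx.elim⟩
  -- the empty condition forces the code over η
  have hf : Forces z o π η η c ∅ := by
    by_contra h
    obtain ⟨q, hq, -, hr⟩ := refutes_dense c hempty h
    obtain ⟨ι, D, hι, hD, hG⟩ := gen_family hinf z o π η η c
    obtain ⟨σ, hσ, hσD⟩ := exists_generic hreg q hq ι D hι hD
    refine (truth hinf (hG σ hσD)).2 q hq hσ hr.forces ((hc _).2 (Or.inl ⟨hm, ?_, hsymm η σ⟩))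
    exact models_iso (hiso η σ) hm
  have hf' : Forces z o π η η' c ∅ :=
    (transfer hI c _ le_rfl le_rfl ∅ hI2 ∅ ∅ ⟨fun _ _ h => h.elim, fun _ _ h => h.elim⟩).1 hf
  obtain ⟨ι, D, hι, hD, hG⟩ := gen_family hinf z o π η η' c
  obtain ⟨σ, hσ, hσD⟩ := exists_generic hreg ∅ hempty ι D hι hD
  rcases (hc _).1 ((truth hinf (hG σ hσD)).1 ∅ hempty hσ hf') with ⟨-, -, τ, hτ⟩ | h
  · exact hniso ⟨τ.trans σ, fun n m v => (hτ n m v).trans (relP_pull ho η' σ n m _)⟩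
  · exact h.1 hm

end GDST
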